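/- Let 1 < p < ∞ and let L^p denote the complex Lebesgue space L^p[0, 2π] of 2π-periodic functions, and let H^p denote the closure in L^p of the linear span of the exponentials e_k(t) = e^{ikt} for integers k ≥ 0. Then there exists a bounded linear projection of L^p onto H^p (M. Riesz), the projection Q determined by Q(e_k) = e_k for k ≥ 0 and Q(e_k) = 0 for k < 0 extends to a bounded projection of L^p onto H^p, Q is the unique bounded projection of L^p onto H^p commuting with all rotations T_g, (T_g f)(t) = f(t + g), and Q is minimal: ‖Q‖ ≤ ‖P‖ for every bounded linear projection P of L^p onto H^p. -/

import Mathlib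

open Real MeasureTheory AddCircle ENNReal

noncomputable section

instance : Fact ((0:ℝ) < 2 * π) := ⟨by positivity⟩

/-- The Hardy space `H^p ⊆ L^p` of the circle `ℝ/2πℤ`: the `L^p`-closure of the span of the
exponentials `e_k(t) = e^{ikt}`, `k ≥ 0`. -/
def HardyLp (p : ℝ≥0∞) [Fact (1 ≤ p)] :
    Submodule ℂ (Lp ℂ p (@haarAddCircle (2 * π) _)) :=
  (Submodule.span ℂ (Set.range fun k : ℕ => fourierLp p (k : ℤ))).topologicalClosure

/-- On the closed right half plane, `|z|^r` is controlled by `(Re z)^r` and `-Re (z^r)`. -/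
theorem exists_norm_rpow_le_re {r : ℝ} (h1 : 1 < r) (h2 : r ≤ 2) :
    ∃ A B : ℝ, 0 ≤ A ∧ 0 ≤ B ∧ ∀ z : ℂ, 0 < z.re →
      ‖z‖ ^ r ≤ A * z.re ^ r - B * (z ^ (r : ℂ)).re := by
  have hπ := Real.pi_pos
  set t : ℝ := π / 4 * (1 + 1 / r) with ht
  have hr : (0 : ℝ) < r := by linarith
  have hrt : r * t = π / 4 * (r + 1) := by rw [ht]; field_simp
  have ht0 : 0 < t := by positivity
  have htπ : t < π / 2 := by
    have : 1 / r < 1 := by rw [div_lt_one hr]; exact h1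
    nlinarith
  have hrt1 : π / 2 < r * t := by rw [hrt]; nlinarith
  have hrt2 : r * t < π := by rw [hrt]; nlinarith
  have hc : 0 < Real.cos t := Real.cos_pos_of_mem_Ioo ⟨by linarith, htπ⟩
  have hcr : Real.cos (r * t) < 0 :=
    Real.cos_neg_of_pi_div_two_lt_of_lt hrt1 (by linarith)
  set B : ℝ := 1 / (-Real.cos (r * t)) with hB
  have hB0 : 0 < B := by rw [hB]; apply one_div_pos.2; linarith
  have hBc : B * Real.cos (r * t) = -1 := by
    rw [hB, one_div, inv_neg, neg_mul, inv_mul_cancel₀ hcr.ne]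
  set A : ℝ := (1 + B) / Real.cos t ^ r with hA
  have hctr : 0 < Real.cos t ^ r := Real.rpow_pos_of_pos hc _
  have hA0 : 0 < A := by positivity
  refine ⟨A, B, hA0.le, hB0.le, fun z hz => ?_⟩
  have hz0 : z ≠ 0 := by rintro rfl; simp at hz
  have hn : 0 < ‖z‖ := norm_pos_iff.2 hz0
  have harg : |z.arg| < π / 2 := Complex.abs_arg_lt_pi_div_two_iff.2 (Or.inl hz)
  set θ := |z.arg| with hθ
  have hθ0 : 0 ≤ θ := abs_nonneg _
  have hre : z.re = ‖z‖ * Real.cos θ := by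
    rw [hθ, Real.cos_abs, Complex.cos_arg hz0]; field_simp
  have hcosθ : 0 < Real.cos θ := Real.cos_pos_of_mem_Ioo ⟨by linarith, harg⟩
  have hpow : (z ^ (r : ℂ)).re = ‖z‖ ^ r * Real.cos (r * θ) := by
    rw [Complex.cpow_ofReal_re, mul_comm z.arg]
    congr 1
    rw [hθ, ← Real.cos_abs, abs_mul, abs_of_pos hr]
  have key : 1 ≤ A * Real.cos θ ^ r - B * Real.cos (r * θ) := by
    rcases le_total θ t with h | h
    · have h3 : Real.cos t ^ r ≤ Real.cos θ ^ r :=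
        Real.rpow_le_rpow hc.le (Real.cos_le_cos_of_nonneg_of_le_pi hθ0 (by linarith) h) hr.le
      have h4 : 1 + B ≤ A * Real.cos θ ^ r := by
        calc 1 + B = A * Real.cos t ^ r := by rw [hA]; field_simp
          _ ≤ _ := by gcongr
      have h5 := Real.cos_le_one (r * θ)
      nlinarith
    · have h3 : Real.cos (r * θ) ≤ Real.cos (r * t) := by
        apply Real.cos_le_cos_of_nonneg_of_le_pi (by positivity)
        · nlinarith
        · gcongr
      have h4 : 0 ≤ A * Real.cos θ ^ r := by positivity
      nlinarith
  rw [hpow, hre, Real.mul_rpow hn.le hcosθ.le]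
  have := mul_le_mul_of_nonneg_left key (Real.rpow_nonneg hn.le r)
  linarith

/-- If the real part of an entire function is positive on the unit circle, it is positive on the
closed unit disc. -/
theorem re_pos_of_re_pos_sphere {G : ℂ → ℂ} (hG : Differentiable ℂ G)
    (hpos : ∀ z ∈ Metric.sphere (0 : ℂ) 1, 0 < (G z).re) {z : ℂ}
    (hz : z ∈ Metric.closedBall (0 : ℂ) 1) : 0 < (G z).re := by
  obtain ⟨w, hw, hmin⟩ := (isCompact_sphere (0 : ℂ) 1).exists_isMinOn
    (NormedSpace.sphere_nonempty.2 zero_le_one)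
    (Complex.continuous_re.comp hG.continuous).continuousOn
  have h := Complex.norm_le_of_forall_mem_frontier_norm_le (f := fun z => Complex.exp (-G z))
    (U := Metric.ball (0 : ℂ) 1) (C := Real.exp (-(G w).re)) Metric.isBounded_ball
    (Differentiable.diffContOnCl (by fun_prop)) (fun z hz => ?_) (z := z)
    (by rwa [closure_ball _ one_ne_zero])
  · rw [Complex.norm_exp, Real.exp_le_exp, Complex.neg_re] at h
    linarith [hpos w hw]
  · rw [frontier_ball _ one_ne_zero] at hz
    rw [Complex.norm_exp, Real.exp_le_exp, Complex.neg_re]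
    have := hmin hz
    simp only [Set.mem_ofPred_eq, Function.comp] at this
    linarith

/-- For `1 < r ≤ 2`, the `r`-mean of an entire function on the unit circle is controlled by that
of its real part, if the latter is positive and the value at the centre is real. -/
theorem exists_circleAverage_norm_rpow_le {r : ℝ} (h1 : 1 < r) (h2 : r ≤ 2) :
    ∃ A : ℝ, 0 ≤ A ∧ ∀ G : ℂ → ℂ, Differentiable ℂ G →
      (∀ z ∈ Metric.sphere (0 : ℂ) 1, 0 < (G z).re) → (G 0).im = 0 →
      Real.circleAverage (fun z => ‖G z‖ ^ r) 0 1 ≤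
        A * Real.circleAverage (fun z => (G z).re ^ r) 0 1 := by
  obtain ⟨A, B, hA, hB, hAB⟩ := exists_norm_rpow_le_re h1 h2
  refine ⟨A, hA, fun G hG hpos him => ?_⟩
  have hball : ∀ z ∈ Metric.closedBall (0 : ℂ) 1, 0 < (G z).re := fun z hz =>
    re_pos_of_re_pos_sphere hG hpos hz
  have hcont : ContinuousOn (fun z => G z ^ (r : ℂ)) (Metric.closedBall (0 : ℂ) 1) :=
    hG.continuous.continuousOn.cpow_const fun z hz => Or.inl (hball z hz)
  have hdiff : DiffContOnCl ℂ (fun z => G z ^ (r : ℂ)) (Metric.ball (0 : ℂ) |1|) := by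
    rw [abs_one]
    refine ⟨fun z hz => ?_, by rwa [closure_ball _ one_ne_zero]⟩
    exact ((hG z).cpow_const
      (Or.inl (hball z (Metric.ball_subset_closedBall hz)))).differentiableWithinAt
  have hmean := hdiff.circleAverage
  have hsub : Metric.sphere (0 : ℂ) |1| ⊆ Metric.closedBall 0 1 := by
    rw [abs_one]; exact Metric.sphere_subset_closedBall
  have hI : CircleIntegrable (fun z => G z ^ (r : ℂ)) 0 1 :=
    (hcont.mono hsub).circleIntegrable'
  have hI1 : CircleIntegrable (fun z => (G z ^ (r : ℂ)).re) 0 1 :=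
    (Complex.continuous_re.comp_continuousOn (hcont.mono hsub)).circleIntegrable'
  have hI2 : CircleIntegrable (fun z => (G z).re ^ r) 0 1 := by
    apply ContinuousOn.circleIntegrable'
    exact (Complex.continuous_re.comp hG.continuous).continuousOn.rpow_const
      fun z _ => Or.inr (by linarith)
  have hI3 : CircleIntegrable (fun z => ‖G z‖ ^ r) 0 1 := by
    apply ContinuousOn.circleIntegrable'
    exact hG.continuous.norm.continuousOn.rpow_const fun z _ => Or.inr (by linarith)
  have hre : Real.circleAverage (fun z => (G z ^ (r : ℂ)).re) 0 1 = (G 0 ^ (r : ℂ)).re := by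
    rw [← hmean]
    exact (Complex.reCLM.circleAverage_comp_comm hI)
  have h0 : 0 ≤ (G 0 ^ (r : ℂ)).re := by
    have hG0 := hball 0 (by simp)
    have : G 0 = ((G 0).re : ℂ) := by apply Complex.ext <;> simp [him]
    rw [this, ← Complex.ofReal_cpow hG0.le, Complex.ofReal_re]
    positivity
  calc Real.circleAverage (fun z => ‖G z‖ ^ r) 0 1
      ≤ Real.circleAverage (fun z => A • (G z).re ^ r - B • (G z ^ (r : ℂ)).re) 0 1 := by
        apply Real.circleAverage_mono hI3 ((hI2.const_fun_smul).sub hI1.const_fun_smul)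
        intro z hz
        exact hAB _ (hball z (hsub hz))
    _ = A * Real.circleAverage (fun z => (G z).re ^ r) 0 1 - B * (G 0 ^ (r : ℂ)).re := by
        rw [Real.circleAverage_fun_sub (hI2.const_fun_smul) hI1.const_fun_smul,
          Real.circleAverage_fun_smul, Real.circleAverage_fun_smul, hre, smul_eq_mul, smul_eq_mul]
    _ ≤ _ := by nlinarith [mul_nonneg hB h0]

local notation "𝕋" => AddCircle (2 * π)

/-- The trigonometric polynomial with given coefficients. -/
def trigPoly : (ℤ →₀ ℂ) →ₗ[ℂ] C(𝕋, ℂ) := Finsupp.linearCombination ℂ fun k => fourier k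

/-- Discarding the coefficients of negative frequency. -/
def nonnegPart : (ℤ →₀ ℂ) →ₗ[ℂ] (ℤ →₀ ℂ) where
  toFun a := a.filter (0 ≤ ·)
  map_add' _ _ := Finsupp.filter_add
  map_smul' _ _ := Finsupp.filter_smul

/-- The polynomial formed by the coefficients of nonnegative frequency. -/
def analyticPolynomial : (ℤ →₀ ℂ) →ₗ[ℂ] Polynomial ℂ :=
  Finsupp.linearCombination ℂ fun k => if 0 ≤ k then Polynomial.X ^ k.toNat else 0

theorem trigPoly_single (k : ℤ) (c : ℂ) : trigPoly (Finsupp.single k c) = c • fourier k := by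
  simp [trigPoly]

theorem nonnegPart_single (k : ℤ) (c : ℂ) :
    nonnegPart (Finsupp.single k c) = if 0 ≤ k then Finsupp.single k c else 0 := by
  change Finsupp.filter _ _ = _
  split_ifs with h
  · exact Finsupp.filter_single_of_pos _ h
  · exact Finsupp.filter_single_of_neg _ h

theorem toAddCircle_analyticPolynomial (a : ℤ →₀ ℂ) :
    (analyticPolynomial a).toAddCircle = trigPoly (nonnegPart a) := by
  suffices h : (Polynomial.toAddCircle.toLinearMap ∘ₗ analyticPolynomial) = trigPoly ∘ₗ nonnegPart
    from LinearMap.congr_fun h a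
  apply Finsupp.lhom_ext
  intro k c
  simp only [LinearMap.comp_apply, nonnegPart_single, analyticPolynomial,
    Finsupp.linearCombination_single, AlgHom.toLinearMap_apply]
  split_ifs with h
  · rw [map_smul, Polynomial.toAddCircle_X_pow_eq_fourier, trigPoly_single, Int.toNat_of_nonneg h]
  · simp

theorem eval_zero_analyticPolynomial (a : ℤ →₀ ℂ) : (analyticPolynomial a).eval 0 = a 0 := by
  suffices h : (Polynomial.leval 0 ∘ₗ analyticPolynomial) = Finsupp.lapply (R := ℂ) 0
    from LinearMap.congr_fun h a
  apply Finsupp.lhom_ext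
  intro k c
  simp only [LinearMap.comp_apply, analyticPolynomial, Finsupp.linearCombination_single,
    Finsupp.lapply_apply, map_smul, Polynomial.leval_apply]
  by_cases h : 0 ≤ k
  · obtain ⟨n, rfl⟩ := Int.eq_ofNat_of_zero_le h
    rcases n with _ | n
    · simp
    · have : ((n + 1 : ℕ) : ℤ) ≠ 0 := by positivity
      rw [if_pos h, Finsupp.single_eq_of_ne' this]
      simp
  · have : k ≠ 0 := by omega
    rw [if_neg h, Finsupp.single_eq_of_ne' this]
    simp

theorem toAddCircle_apply_eq_eval (P : Polynomial ℂ) (x : 𝕋) :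
    P.toAddCircle x = P.eval (x.toCircle : ℂ) := by
  induction P using Polynomial.induction_on' with
  | add p q hp hq => simp [hp, hq]
  | monomial n c =>
    rw [Polynomial.toAddCircle_monomial_eq_smul_fourier]
    simp [AddCircle.toCircle_nsmul]

theorem integral_toCircle_eq_circleAverage (g : ℂ → ℝ) :
    ∫ x : 𝕋, g (x.toCircle : ℂ) ∂haarAddCircle = Real.circleAverage g 0 1 := by
  rw [AddCircle.integral_haarAddCircle, Real.circleAverage,
    ← AddCircle.intervalIntegral_preimage (2 * π) 0]
  simp only [zero_add]
  congr 1
  apply intervalIntegral.integral_congr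
  intro t _
  simp [AddCircle.toCircle_apply_mk, circleMap]

theorem integrable_haarAddCircle {E : Type*} [NormedAddCommGroup E] {f : 𝕋 → E}
    (hf : Continuous f) : Integrable f (@haarAddCircle (2 * π) _) :=
  hf.integrable_of_hasCompactSupport (HasCompactSupport.of_compactSpace f)

theorem fourierCoeff_trigPoly (a : ℤ →₀ ℂ) (k : ℤ) : fourierCoeff (trigPoly a) k = a k := by
  induction a using Finsupp.induction_linear with
  | zero => simp [fourierCoeff]
  | add f g hf hg =>
    rw [map_add, ContinuousMap.coe_add,
      fourierCoeff.add (integrable_haarAddCircle (map_continuous _))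
      (integrable_haarAddCircle (map_continuous _)), Pi.add_apply, hf, hg, Finsupp.add_apply]
  | single j c =>
    rw [trigPoly_single, ContinuousMap.coe_smul, fourierCoeff.const_smul, fourierCoeff_fourier]
    simp [Finsupp.single_apply, Pi.single_apply, eq_comm]

theorem coeff_neg_of_real {a : ℤ →₀ ℂ} (ha : ∀ x, (trigPoly a x).im = 0) (k : ℤ) :
    a (-k) = (starRingEnd ℂ) (a k) := by
  rw [← fourierCoeff_trigPoly a (-k), ← fourierCoeff_trigPoly a k, fourierCoeff, fourierCoeff,
    ← integral_conj]
  congr 1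
  ext x
  rw [smul_eq_mul, smul_eq_mul, map_mul, ← fourier_neg, Complex.conj_eq_iff_im.2 (ha x)]

theorem trigPoly_apply (a : ℤ →₀ ℂ) (x : 𝕋) :
    trigPoly a x = ∑ k ∈ a.support, a k * fourier k x := by
  simp [trigPoly, Finsupp.linearCombination_apply, Finsupp.sum]

theorem trigPoly_nonnegPart_apply (a : ℤ →₀ ℂ) (x : 𝕋) :
    trigPoly (nonnegPart a) x = ∑ k ∈ a.support, if 0 ≤ k then a k * fourier k x else 0 := by
  rw [trigPoly_apply, ← Finset.sum_filter]
  have : (nonnegPart a).support = a.support.filter (0 ≤ ·) := Finsupp.support_filter ..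
  rw [this]
  refine Finset.sum_congr rfl fun k hk => ?_
  congr 1
  exact Finsupp.filter_apply_pos _ _ (Finset.mem_filter.1 hk).2

/-- For a real trigonometric polynomial, the real part of its analytic part is the half sum of the
polynomial and its mean. -/
theorem re_trigPoly_nonnegPart {a : ℤ →₀ ℂ} (ha : ∀ x, (trigPoly a x).im = 0) (x : 𝕋) :
    ((trigPoly (nonnegPart a) x).re : ℂ) = (trigPoly a x + a 0) / 2 := by
  have hneg := coeff_neg_of_real ha
  rw [Complex.re_eq_add_conj, trigPoly_nonnegPart_apply, map_sum]
  congr 1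
  have h1 : ∑ k ∈ a.support, (starRingEnd ℂ) (if 0 ≤ k then a k * fourier k x else 0) =
      ∑ k ∈ a.support, if k ≤ 0 then a k * fourier k x else 0 := by
    refine Finset.sum_nbij' (fun k => -k) (fun k => -k) ?_ ?_ (by simp) (by simp) ?_
    · intro k hk; simpa [hneg] using hk
    · intro k hk; simpa [hneg] using hk
    · intro k hk
      simp only [hneg, fourier_neg, Left.neg_nonpos_iff]
      split_ifs <;> simp
  have h2 : a 0 = ∑ k ∈ a.support, if k = 0 then a k * fourier k x else 0 := by
    simp [Finset.sum_ite_eq']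
  rw [h1, trigPoly_apply, h2, ← Finset.sum_add_distrib, ← Finset.sum_add_distrib]
  refine Finset.sum_congr rfl fun k _ => ?_
  rcases lt_trichotomy k 0 with h | h | h
  · simp [h.le, h.not_ge, h.ne]
  · simp [h]
  · simp [h.le, h.not_ge, h.ne']

local notation "μ𝕋" => (@haarAddCircle (2 * π) _)

/-- The `L^p` class of a continuous function on the circle. -/
abbrev circleToLp (p : ℝ≥0∞) [Fact (1 ≤ p)] : C(𝕋, ℂ) →L[ℂ] Lp ℂ p μ𝕋 :=
  ContinuousMap.toLp p μ𝕋 ℂ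

theorem norm_circleToLp_eq_eLpNorm (p : ℝ≥0∞) [Fact (1 ≤ p)] (f : C(𝕋, ℂ)) :
    ‖circleToLp p f‖ = (eLpNorm f p μ𝕋).toReal := by
  rw [Lp.norm_def, eLpNorm_congr_ae (ContinuousMap.coeFn_toLp μ𝕋 f)]

theorem norm_circleToLp_rpow {p : ℝ≥0∞} [Fact (1 ≤ p)] (hp : p ≠ ⊤) (f : C(𝕋, ℂ)) :
    ‖circleToLp p f‖ ^ p.toReal = ∫ x, ‖f x‖ ^ p.toReal ∂μ𝕋 := by
  have hp0 : p ≠ 0 := (zero_lt_one.trans_le Fact.out).ne'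
  have hI : 0 ≤ ∫ x, ‖f x‖ ^ p.toReal ∂μ𝕋 := integral_nonneg fun x => by positivity
  rw [norm_circleToLp_eq_eLpNorm, (f.memLp μ𝕋 ℂ).eLpNorm_eq_integral_rpow_norm hp0 hp,
    ENNReal.toReal_ofReal (by positivity), ← Real.rpow_mul hI,
    inv_mul_cancel₀ (ENNReal.toReal_pos hp0 hp).ne', Real.rpow_one]

theorem norm_circleToLp_le_norm (p : ℝ≥0∞) [Fact (1 ≤ p)] (f : C(𝕋, ℂ)) :
    ‖circleToLp p f‖ ≤ ‖f‖ := by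
  refine ((circleToLp p).le_opNorm f).trans ?_
  have h := ContinuousMap.toLp_norm_le (p := p) (E := ℂ) (𝕜 := ℂ) μ𝕋
  have h1 : measureUnivNNReal μ𝕋 = 1 := by simp [measureUnivNNReal]
  rw [h1] at h
  simp only [NNReal.coe_one, Real.one_rpow] at h
  exact mul_le_of_le_one_left (norm_nonneg _) h

theorem norm_circleToLp_mono {p q : ℝ≥0∞} [Fact (1 ≤ p)] [Fact (1 ≤ q)] (hpq : p ≤ q)
    (f : C(𝕋, ℂ)) : ‖circleToLp p f‖ ≤ ‖circleToLp q f‖ := by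
  rw [norm_circleToLp_eq_eLpNorm, norm_circleToLp_eq_eLpNorm]
  exact ENNReal.toReal_mono (f.memLp μ𝕋 ℂ).eLpNorm_ne_top
    (eLpNorm_le_eLpNorm_of_exponent_le hpq (map_continuous f).aestronglyMeasurable)

theorem norm_circleToLp_le_of_norm_le {p : ℝ≥0∞} [Fact (1 ≤ p)] {f g : C(𝕋, ℂ)}
    (h : ∀ x, ‖f x‖ ≤ ‖g x‖) : ‖circleToLp p f‖ ≤ ‖circleToLp p g‖ := by
  rw [norm_circleToLp_eq_eLpNorm, norm_circleToLp_eq_eLpNorm]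
  exact ENNReal.toReal_mono (g.memLp μ𝕋 ℂ).eLpNorm_ne_top (eLpNorm_mono h)

theorem norm_integral_le_norm_circleToLp (p : ℝ≥0∞) [Fact (1 ≤ p)] (f : C(𝕋, ℂ)) :
    ‖∫ x, f x ∂μ𝕋‖ ≤ ‖circleToLp p f‖ := by
  have h : ‖circleToLp 1 f‖ = ∫ x, ‖f x‖ ∂μ𝕋 := by
    simpa using norm_circleToLp_rpow ENNReal.one_ne_top f
  exact (norm_integral_le_integral_norm _).trans (h ▸ norm_circleToLp_mono Fact.out f)

theorem norm_coeff_zero_le (p : ℝ≥0∞) [Fact (1 ≤ p)] (a : ℤ →₀ ℂ) :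
    ‖a 0‖ ≤ ‖circleToLp p (trigPoly a)‖ := by
  have h := fourierCoeff_trigPoly a 0
  simp only [fourierCoeff, neg_zero, fourier_zero, one_smul] at h
  rw [← h]
  exact norm_integral_le_norm_circleToLp p _

/-- The bound for the analytic part of a positive trigonometric polynomial. -/
theorem exists_norm_nonnegPart_le_of_pos {p : ℝ≥0∞} [Fact (1 ≤ p)] (hp₁ : 1 < p) (hp₂ : p ≤ 2) :
    ∃ A : ℝ, 0 ≤ A ∧ ∀ a : ℤ →₀ ℂ, (∀ x, 0 < (trigPoly a x).re) → (∀ x, (trigPoly a x).im = 0) →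
      ‖circleToLp p (trigPoly (nonnegPart a))‖ ≤ A * ‖circleToLp p (trigPoly a)‖ := by
  have hp : p ≠ ⊤ := ne_top_of_le_ne_top (by simp) hp₂
  have h1 : 1 < p.toReal := by
    rw [← ENNReal.toReal_one]; exact (ENNReal.toReal_lt_toReal (by simp) hp).2 hp₁
  have h2 : p.toReal ≤ 2 := ENNReal.toReal_le_of_le_ofReal (by norm_num) (by simpa using hp₂)
  have hr : 0 < p.toReal := by linarith
  obtain ⟨A, hA, H⟩ := exists_circleAverage_norm_rpow_le h1 h2
  refine ⟨A ^ p.toReal⁻¹, by positivity, fun a hpos hreal => ?_⟩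
  set P := analyticPolynomial a with hP
  have heval : ∀ x : 𝕋, P.eval (x.toCircle : ℂ) = trigPoly (nonnegPart a) x := fun x => by
    rw [← toAddCircle_apply_eq_eval, toAddCircle_analyticPolynomial]
  have hre := re_trigPoly_nonnegPart hreal
  have ha0 : a 0 = ∫ x, trigPoly a x ∂μ𝕋 := by
    have h := fourierCoeff_trigPoly a 0
    simp only [fourierCoeff, neg_zero, fourier_zero, one_smul] at h
    exact h.symm
  have htr : ∀ x, trigPoly a x = ((trigPoly a x).re : ℂ) := fun x => by
    apply Complex.ext <;> simp [hreal x]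
  have ha0' : a 0 = ((∫ x, (trigPoly a x).re ∂μ𝕋 : ℝ) : ℂ) := by
    rw [ha0, ← integral_complex_ofReal]
    exact integral_congr_ae (.of_forall htr)
  have hmean : 0 ≤ ∫ x, (trigPoly a x).re ∂μ𝕋 := integral_nonneg fun x => (hpos x).le
  have hrepos : ∀ x, 0 < (trigPoly (nonnegPart a) x).re := fun x => by
    have h := hre x
    rw [htr x, ha0'] at h
    have h' : (trigPoly (nonnegPart a) x).re =
        ((trigPoly a x).re + ∫ x, (trigPoly a x).re ∂μ𝕋) / 2 := by exact_mod_cast h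
    rw [h']
    linarith [hpos x]
  have key := H (fun z => P.eval z) P.differentiable (fun z hz => by
      obtain ⟨x, hx⟩ := (AddCircle.homeomorphCircle (T := 2 * π) (by positivity)).surjective
        ⟨z, hz⟩
      have hx' : (x.toCircle : ℂ) = z := by
        rw [← AddCircle.homeomorphCircle_apply (by positivity), hx]
      rw [← hx', heval]
      exact hrepos x) (by
      rw [eval_zero_analyticPolynomial, ha0', Complex.ofReal_im])
  rw [← integral_toCircle_eq_circleAverage, ← integral_toCircle_eq_circleAverage] at key
  simp only [heval] at key
  set g : C(𝕋, ℂ) := (1 / 2 : ℂ) • (trigPoly a + a 0 • fourier 0) with hg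
  have hgnorm : ‖circleToLp p g‖ ≤ ‖circleToLp p (trigPoly a)‖ := by
    have e1 : ‖circleToLp p (a 0 • fourier 0)‖ ≤ ‖circleToLp p (trigPoly a)‖ := by
      refine (norm_circleToLp_le_norm p _).trans ?_
      rw [norm_smul, fourier_norm, mul_one]
      exact norm_coeff_zero_le p a
    rw [hg, map_smul, norm_smul, map_add]
    have e2 := norm_add_le (circleToLp p (trigPoly a)) (circleToLp p (a 0 • fourier 0))
    have e3 : ‖(1 / 2 : ℂ)‖ = 1 / 2 := by simp
    rw [e3]
    linarith
  have hgre : ∀ x, (trigPoly (nonnegPart a) x).re = ‖g x‖ := fun x => by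
    rw [← abs_of_pos (hrepos x), ← Real.norm_eq_abs, ← Complex.norm_real, hre x, hg]
    congr 1
    simp
    ring
  simp only [hgre] at key
  rw [← norm_circleToLp_rpow hp, ← norm_circleToLp_rpow hp] at key
  have e4 : A = (A ^ p.toReal⁻¹) ^ p.toReal := by
    rw [← Real.rpow_mul hA, inv_mul_cancel₀ hr.ne', Real.rpow_one]
  rw [e4, ← Real.mul_rpow (by positivity) (norm_nonneg _)] at key
  refine ((Real.rpow_le_rpow_iff (norm_nonneg _) (by positivity) hr).1 key).trans ?_
  gcongr

theorem circleToLp_two_trigPoly (a : ℤ →₀ ℂ) :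
    circleToLp 2 (trigPoly a) = Finsupp.linearCombination ℂ (fourierLp (T := 2 * π) 2) a := by
  simp only [trigPoly, Finsupp.linearCombination_apply, Finsupp.sum, map_sum, map_smul]

theorem inner_nonnegPart (a b : ℤ →₀ ℂ) :
    inner ℂ (circleToLp 2 (trigPoly (nonnegPart a))) (circleToLp 2 (trigPoly b)) =
      inner ℂ (circleToLp 2 (trigPoly a)) (circleToLp 2 (trigPoly (nonnegPart b))) := by
  simp only [circleToLp_two_trigPoly]
  have ho := orthonormal_fourier (T := 2 * π)
  induction a using Finsupp.induction_linear with
  | zero => simp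
  | add f g hf hg => simp only [map_add, inner_add_left, hf, hg]
  | single k c =>
    rw [nonnegPart_single, ho.inner_finsupp_eq_sum_left, ho.inner_finsupp_eq_sum_left,
      Finsupp.sum_single_index (by simp)]
    change _ = _ * (Finsupp.filter _ b) k
    rw [Finsupp.filter_apply]
    split_ifs <;> simp

theorem norm_two_nonnegPart_le (a : ℤ →₀ ℂ) :
    ‖circleToLp 2 (trigPoly (nonnegPart a))‖ ≤ ‖circleToLp 2 (trigPoly a)‖ := by
  have hidem : nonnegPart (nonnegPart a) = nonnegPart a := by
    ext k
    change Finsupp.filter _ (Finsupp.filter _ a) k = Finsupp.filter _ a k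
    simp only [Finsupp.filter_apply]
    split_ifs <;> rfl
  set u := circleToLp 2 (trigPoly (nonnegPart a))
  set v := circleToLp 2 (trigPoly a)
  have h : inner ℂ u u = inner ℂ v u := by
    have := inner_nonnegPart a (nonnegPart a)
    rwa [hidem] at this
  have h1 : ‖u‖ * ‖u‖ ≤ ‖v‖ * ‖u‖ := by
    rw [← inner_self_eq_norm_mul_norm (𝕜 := ℂ) u, h]
    exact (RCLike.re_le_norm _).trans (norm_inner_le_norm v u)
  rcases (norm_nonneg u).eq_or_lt with h0 | h0
  · rw [← h0]; exact norm_nonneg v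
  · exact le_of_mul_le_mul_right h1 h0

theorem le_of_forall_pos_le_add_mul {x y K : ℝ} (hK : 0 ≤ K) (h : ∀ ε : ℝ, 0 < ε → x ≤ y + K * ε) :
    x ≤ y := by
  refine le_of_forall_pos_le_add fun δ hδ => (h (δ / (K + 1)) (by positivity)).trans ?_
  rw [add_le_add_iff_left, mul_div_assoc', div_le_iff₀ (by positivity)]
  nlinarith

theorem range_trigPoly :
    LinearMap.range trigPoly = Submodule.span ℂ (Set.range (@fourier (2 * π))) :=
  Finsupp.range_linearCombination ℂ

theorem exists_norm_trigPoly_sub_lt (f : C(𝕋, ℂ)) {ε : ℝ} (hε : 0 < ε) :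
    ∃ a, ‖trigPoly a - f‖ < ε := by
  have hf : f ∈ (Submodule.span ℂ (Set.range (@fourier (2 * π)))).topologicalClosure := by
    rw [span_fourier_closure_eq_top]; trivial
  rw [← range_trigPoly, ← SetLike.mem_coe, Submodule.topologicalClosure_coe] at hf
  obtain ⟨g, ⟨a, rfl⟩, hg⟩ := Metric.mem_closure_iff.1 hf ε hε
  exact ⟨a, by rwa [← dist_eq_norm, dist_comm]⟩

theorem exists_trigPoly_eq_star (a : ℤ →₀ ℂ) : ∃ b, trigPoly b = star (trigPoly a) := by
  induction a using Finsupp.induction_linear with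
  | zero => exact ⟨0, by simp⟩
  | add f g hf hg =>
    obtain ⟨b, hb⟩ := hf
    obtain ⟨c, hc⟩ := hg
    exact ⟨b + c, by rw [map_add, map_add, hb, hc, star_add]⟩
  | single k c =>
    refine ⟨Finsupp.single (-k) (star c), ?_⟩
    ext x
    simp [trigPoly_single]

theorem exists_trigPoly_eq_re (a : ℤ →₀ ℂ) :
    ∃ b, ∀ x, trigPoly b x = ((trigPoly a x).re : ℂ) := by
  obtain ⟨b, hb⟩ := exists_trigPoly_eq_star a
  refine ⟨(1 / 2 : ℂ) • (a + b), fun x => ?_⟩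
  rw [Complex.re_eq_add_conj, map_smul, map_add, hb]
  simp
  ring

/-- Nonnegative continuous functions are uniform limits of positive trigonometric polynomials. -/
theorem exists_pos_trigPoly_norm_sub_le (g : C(𝕋, ℝ)) (hg : ∀ x, 0 ≤ g x) {ε : ℝ} (hε : 0 < ε)
    (f : C(𝕋, ℂ)) (hf : ∀ x, f x = (g x : ℂ)) :
    ∃ b, (∀ x, 0 < (trigPoly b x).re) ∧ (∀ x, (trigPoly b x).im = 0) ∧ ‖trigPoly b - f‖ ≤ ε := by
  obtain ⟨a, ha⟩ :=
    exists_norm_trigPoly_sub_lt (f + ((ε / 2 : ℝ) : ℂ) • (1 : C(𝕋, ℂ))) (half_pos hε)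
  obtain ⟨b, hb⟩ := exists_trigPoly_eq_re a
  have h : ∀ x, |(trigPoly a x).re - (g x + ε / 2)| < ε / 2 := fun x => by
    refine lt_of_le_of_lt ?_ ha
    refine le_trans ?_ (ContinuousMap.norm_coe_le_norm _ x)
    refine le_trans (le_of_eq ?_) (Complex.abs_re_le_norm _)
    simp [hf]
  refine ⟨b, fun x => ?_, fun x => by simp [hb], ?_⟩
  · rw [hb, Complex.ofReal_re]
    linarith [(abs_lt.1 (h x)).1, hg x]
  · rw [ContinuousMap.norm_le _ hε.le]
    intro x
    rw [ContinuousMap.sub_apply, hb, hf, ← Complex.ofReal_sub, Complex.norm_real, Real.norm_eq_abs,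
      abs_le]
    have := abs_lt.1 (h x)
    constructor <;> linarith

/-- Boundedness of the Riesz projection on trigonometric polynomials, `1 < p ≤ 2`. -/
theorem exists_norm_nonnegPart_le_of_le_two {p : ℝ≥0∞} [Fact (1 ≤ p)] (hp₁ : 1 < p) (hp₂ : p ≤ 2) :
    ∃ A : ℝ, 0 ≤ A ∧ ∀ a : ℤ →₀ ℂ,
      ‖circleToLp p (trigPoly (nonnegPart a))‖ ≤ A * ‖circleToLp p (trigPoly a)‖ := by
  obtain ⟨A, hA, H⟩ := exists_norm_nonnegPart_le_of_pos hp₁ hp₂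
  refine ⟨4 * A, by positivity, fun a => ?_⟩
  set U : (ℤ →₀ ℂ) →ₗ[ℂ] Lp ℂ p μ𝕋 := (circleToLp p).toLinearMap ∘ₗ trigPoly ∘ₗ nonnegPart
  change ‖U a‖ ≤ _
  set N := ‖circleToLp p (trigPoly a)‖ with hN
  have part : ∀ (l : ℂ → ℝ), Continuous l → (∀ z, 0 ≤ l z) → (∀ z, l z ≤ ‖z‖) → ∀ ε : ℝ, 0 < ε →
      ∃ b, ‖U b‖ ≤ A * (N + ε) ∧ ∀ x, ‖trigPoly b x - (l (trigPoly a x) : ℂ)‖ ≤ ε := by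
    intro l hl hl0 hl1 ε hε
    let g : C(𝕋, ℝ) := ⟨fun x => l (trigPoly a x), by fun_prop⟩
    let f : C(𝕋, ℂ) := ⟨fun x => (l (trigPoly a x) : ℂ), by fun_prop⟩
    obtain ⟨b, hb1, hb2, hb3⟩ :=
      exists_pos_trigPoly_norm_sub_le g (fun x => hl0 _) hε f (fun x => rfl)
    refine ⟨b, (H b hb1 hb2).trans ?_,
      fun x => (ContinuousMap.norm_coe_le_norm (trigPoly b - f) x).trans hb3⟩
    gcongr
    have h1 : ‖circleToLp p f‖ ≤ N := norm_circleToLp_le_of_norm_le fun x => by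
      change ‖((l (trigPoly a x) : ℝ) : ℂ)‖ ≤ _
      rw [Complex.norm_real, Real.norm_of_nonneg (hl0 _)]
      exact hl1 _
    have h2 : ‖circleToLp p (trigPoly b - f)‖ ≤ ε := (norm_circleToLp_le_norm p _).trans hb3
    rw [map_sub] at h2
    linarith [norm_sub_norm_le (circleToLp p (trigPoly b)) (circleToLp p f)]
  have main : ∀ ε : ℝ, 0 < ε → ‖U a‖ ≤ 4 * A * N + (4 * A + 4) * ε := by
    intro ε hε
    obtain ⟨b₁, hU₁, h₁⟩ := part (fun z => max z.re 0) (by fun_prop) (fun z => le_max_right _ _)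
      (fun z => max_le ((le_abs_self _).trans (Complex.abs_re_le_norm z)) (norm_nonneg z)) ε hε
    obtain ⟨b₂, hU₂, h₂⟩ := part (fun z => max (-z.re) 0) (by fun_prop) (fun z => le_max_right _ _)
      (fun z => max_le ((neg_le_abs _).trans (Complex.abs_re_le_norm z)) (norm_nonneg z)) ε hε
    obtain ⟨b₃, hU₃, h₃⟩ := part (fun z => max z.im 0) (by fun_prop) (fun z => le_max_right _ _)
      (fun z => max_le ((le_abs_self _).trans (Complex.abs_im_le_norm z)) (norm_nonneg z)) ε hε
    obtain ⟨b₄, hU₄, h₄⟩ := part (fun z => max (-z.im) 0) (by fun_prop) (fun z => le_max_right _ _)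
      (fun z => max_le ((neg_le_abs _).trans (Complex.abs_im_le_norm z)) (norm_nonneg z)) ε hε
    set b := b₁ - b₂ + Complex.I • (b₃ - b₄) with hb
    have hsmall : ‖trigPoly (a - b)‖ ≤ 4 * ε := by
      rw [ContinuousMap.norm_le _ (by positivity)]
      intro x
      have hz : ∀ z : ℂ, z = ((max z.re 0 : ℝ) : ℂ) - ((max (-z.re) 0 : ℝ) : ℂ) +
          Complex.I * (((max z.im 0 : ℝ) : ℂ) - ((max (-z.im) 0 : ℝ) : ℂ)) := by
        intro z
        have e : ∀ t : ℝ, max t 0 - max (-t) 0 = t := fun t => by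
          rcases le_total t 0 with h | h <;> simp [h]
        rw [← Complex.ofReal_sub, ← Complex.ofReal_sub, e, e, mul_comm, Complex.re_add_im]
      have hx : trigPoly (a - b) x =
          -(trigPoly b₁ x - ((max (trigPoly a x).re 0 : ℝ) : ℂ)) +
          (trigPoly b₂ x - ((max (-(trigPoly a x).re) 0 : ℝ) : ℂ)) +
          -(Complex.I * (trigPoly b₃ x - ((max (trigPoly a x).im 0 : ℝ) : ℂ))) +
          Complex.I * (trigPoly b₄ x - ((max (-(trigPoly a x).im) 0 : ℝ) : ℂ)) := by
        have hza := hz (trigPoly a x)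
        simp only [hb, map_sub, map_add, map_smul, ContinuousMap.sub_apply, ContinuousMap.add_apply,
          ContinuousMap.smul_apply, smul_eq_mul]
        linear_combination hza
      rw [hx]
      refine (norm_add₄_le).trans ?_
      simp only [norm_neg, norm_mul, Complex.norm_I, one_mul]
      linarith [h₁ x, h₂ x, h₃ x, h₄ x]
    have hUsmall : ‖U (a - b)‖ ≤ 4 * ε :=
      (norm_circleToLp_mono hp₂ _).trans ((norm_two_nonnegPart_le _).trans
        ((norm_circleToLp_le_norm 2 _).trans hsmall))
    have hUa : U a = U (a - b) + U b₁ + -U b₂ + Complex.I • U b₃ + -(Complex.I • U b₄) := by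
      rw [map_sub, hb, map_add, map_sub, map_smul, map_sub, smul_sub]
      abel
    rw [hUa]
    have n1 := norm_add_le (U (a - b) + U b₁ + -U b₂ + Complex.I • U b₃) (-(Complex.I • U b₄))
    have n2 := norm_add_le (U (a - b) + U b₁ + -U b₂) (Complex.I • U b₃)
    have n3 := norm_add_le (U (a - b) + U b₁) (-U b₂)
    have n4 := norm_add_le (U (a - b)) (U b₁)
    rw [norm_neg, norm_smul, Complex.norm_I, one_mul] at n1
    rw [norm_smul, Complex.norm_I, one_mul] at n2
    rw [norm_neg] at n3
    linarith
  exact le_of_forall_pos_le_add_mul (by positivity) main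

theorem norm_integral_mul_conj_le {p q : ℝ≥0∞} [Fact (1 ≤ p)] [Fact (1 ≤ q)] (hp : p ≠ ⊤)
    (hq : q ≠ ⊤) (hpq : p.toReal.HolderConjugate q.toReal) (f g : C(𝕋, ℂ)) :
    ‖∫ x, f x * (starRingEnd ℂ) (g x) ∂μ𝕋‖ ≤ ‖circleToLp p f‖ * ‖circleToLp q g‖ := by
  have hroot : ∀ {s : ℝ≥0∞} [Fact (1 ≤ s)], s ≠ ⊤ → ∀ h : C(𝕋, ℂ),
      (∫ x, ‖h x‖ ^ s.toReal ∂μ𝕋) ^ (1 / s.toReal) = ‖circleToLp s h‖ := by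
    intro s _ hs h
    have hs0 : s ≠ 0 := (zero_lt_one.trans_le Fact.out).ne'
    rw [← norm_circleToLp_rpow hs, ← Real.rpow_mul (norm_nonneg _),
      mul_one_div_cancel (ENNReal.toReal_pos hs0 hs).ne', Real.rpow_one]
  calc ‖∫ x, f x * (starRingEnd ℂ) (g x) ∂μ𝕋‖ ≤ ∫ x, ‖f x‖ * ‖g x‖ ∂μ𝕋 := by
        refine (norm_integral_le_integral_norm _).trans (le_of_eq ?_)
        simp
    _ ≤ _ := by
        have := integral_mul_norm_le_Lp_mul_Lq (μ := μ𝕋) (f := f) (g := g) hpq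
          (by rw [ENNReal.ofReal_toReal hp]; exact f.memLp μ𝕋 ℂ)
          (by rw [ENNReal.ofReal_toReal hq]; exact g.memLp μ𝕋 ℂ)
        rwa [hroot hp, hroot hq] at this

theorem integral_nonnegPart_mul_conj (a b : ℤ →₀ ℂ) :
    ∫ x, trigPoly (nonnegPart a) x * (starRingEnd ℂ) (trigPoly b x) ∂μ𝕋 =
      ∫ x, trigPoly a x * (starRingEnd ℂ) (trigPoly (nonnegPart b) x) ∂μ𝕋 := by
  have h := inner_nonnegPart b a
  simp only [circleToLp, ContinuousMap.inner_toLp] at h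
  exact h.symm

/-- The function dual to a continuous function in the pairing of `L^p` and `L^q`. -/
theorem exists_dual_function {p q : ℝ≥0∞} [Fact (1 ≤ p)] [Fact (1 ≤ q)] (hp : p ≠ ⊤)
    (hq : q ≠ ⊤) (hpq : p.toReal.HolderConjugate q.toReal) (hp₂ : 2 ≤ p.toReal) (h : C(𝕋, ℂ)) :
    ∃ g : C(𝕋, ℂ), ‖circleToLp q g‖ = ‖circleToLp p h‖ ^ (p.toReal - 1) ∧
      ‖∫ x, h x * (starRingEnd ℂ) (g x) ∂μ𝕋‖ = ‖circleToLp p h‖ ^ p.toReal := by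
  set r := p.toReal with hr
  set N := ‖circleToLp p h‖ with hN
  let g : C(𝕋, ℂ) := ⟨fun x => ((‖h x‖ ^ (r - 2) : ℝ) : ℂ) * h x, by
    refine Continuous.mul (Complex.continuous_ofReal.comp ?_) (map_continuous h)
    exact (map_continuous h).norm.rpow_const fun x => Or.inr (by linarith)⟩
  have hgnorm : ∀ x, ‖g x‖ = ‖h x‖ ^ (r - 1) := fun x => by
    change ‖((‖h x‖ ^ (r - 2) : ℝ) : ℂ) * h x‖ = _
    rw [norm_mul, Complex.norm_real, Real.norm_of_nonneg (by positivity),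
      show r - 1 = r - 2 + 1 by ring, Real.rpow_add_one' (norm_nonneg _) (by linarith)]
  have hgLq : ‖circleToLp q g‖ = N ^ (r - 1) := by
    rw [← Real.rpow_left_inj (norm_nonneg _) (by positivity) hpq.symm.pos.ne',
      norm_circleToLp_rpow hq, ← Real.rpow_mul (norm_nonneg _), hpq.sub_one_mul_conj,
      norm_circleToLp_rpow hp]
    simp only [hgnorm]
    congr 1
    ext x
    rw [← Real.rpow_mul (norm_nonneg _), hpq.sub_one_mul_conj]
  have hpair : ‖∫ x, h x * (starRingEnd ℂ) (g x) ∂μ𝕋‖ = N ^ r := by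
    have e : ∀ x, h x * (starRingEnd ℂ) (g x) = ((‖h x‖ ^ r : ℝ) : ℂ) := fun x => by
      change h x * (starRingEnd ℂ) (((‖h x‖ ^ (r - 2) : ℝ) : ℂ) * h x) = _
      rw [map_mul, Complex.conj_ofReal, mul_left_comm, Complex.mul_conj, ← Complex.ofReal_mul,
        Complex.normSq_eq_norm_sq, ← Real.rpow_natCast, ← Real.rpow_add' (norm_nonneg _)]
      · norm_num
      · norm_num; linarith
    simp only [e]
    rw [integral_complex_ofReal, Complex.norm_real, ← norm_circleToLp_rpow hp,
      Real.norm_of_nonneg (by positivity)]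
  exact ⟨g, hgLq, hpair⟩

/-- Boundedness of the Riesz projection on trigonometric polynomials passes to the conjugate
exponent. -/
theorem norm_nonnegPart_le_of_conjugate {p q : ℝ≥0∞} [Fact (1 ≤ p)] [Fact (1 ≤ q)] (hp : p ≠ ⊤)
    (hq : q ≠ ⊤) (hpq : p.toReal.HolderConjugate q.toReal) (hp₂ : 2 ≤ p.toReal) {A : ℝ}
    (hA : 0 ≤ A) (H : ∀ a : ℤ →₀ ℂ,
      ‖circleToLp q (trigPoly (nonnegPart a))‖ ≤ A * ‖circleToLp q (trigPoly a)‖) (a : ℤ →₀ ℂ) :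
    ‖circleToLp p (trigPoly (nonnegPart a))‖ ≤ A * ‖circleToLp p (trigPoly a)‖ := by
  set h := trigPoly (nonnegPart a) with hh
  set r := p.toReal with hr
  set N := ‖circleToLp p h‖ with hN
  set M := ‖circleToLp p (trigPoly a)‖ with hM
  obtain ⟨g, hgLq, hpair⟩ := exists_dual_function hp hq hpq hp₂ h
  have main : ∀ ε : ℝ, 0 < ε → N ^ r ≤ A * M * N ^ (r - 1) + (N + A * M) * ε := by
    intro ε hε
    obtain ⟨b, hb⟩ := exists_norm_trigPoly_sub_lt g hε
    have hb' : ‖circleToLp q (trigPoly b - g)‖ ≤ ε := (norm_circleToLp_le_norm q _).trans hb.le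
    have e : ∫ x, h x * (starRingEnd ℂ) (g x) ∂μ𝕋 =
        (∫ x, trigPoly a x * (starRingEnd ℂ) (trigPoly (nonnegPart b) x) ∂μ𝕋) -
          ∫ x, h x * (starRingEnd ℂ) ((trigPoly b - g) x) ∂μ𝕋 := by
      rw [← integral_nonnegPart_mul_conj, ← integral_sub]
      · congr 1
        ext x
        rw [ContinuousMap.sub_apply, map_sub]
        ring
      · exact integrable_haarAddCircle (by fun_prop)
      · exact integrable_haarAddCircle (by fun_prop)
    have b1 := norm_integral_mul_conj_le hp hq hpq (trigPoly a) (trigPoly (nonnegPart b))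
    have b2 := norm_integral_mul_conj_le hp hq hpq h (trigPoly b - g)
    have b3 : ‖circleToLp q (trigPoly b)‖ ≤ N ^ (r - 1) + ε := by
      rw [map_sub] at hb'
      linarith [norm_sub_norm_le (circleToLp q (trigPoly b)) (circleToLp q g)]
    rw [← hpair, e]
    refine (norm_sub_le _ _).trans ?_
    have b4 : M * ‖circleToLp q (trigPoly (nonnegPart b))‖ ≤ M * (A * (N ^ (r - 1) + ε)) := by
      gcongr
      exact (H b).trans (by gcongr)
    have b5 : N * ‖circleToLp q (trigPoly b - g)‖ ≤ N * ε := by gcongr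
    linarith
  have hle : N ^ r ≤ A * M * N ^ (r - 1) :=
    le_of_forall_pos_le_add_mul
      (add_nonneg (norm_nonneg _) (mul_nonneg hA (norm_nonneg _))) main
  rcases (norm_nonneg (circleToLp p h)).eq_or_lt with h0 | h0
  · rw [hN, ← h0]; positivity
  · have hNpos : 0 < N ^ (r - 1) := Real.rpow_pos_of_pos h0 _
    have hsplit : N ^ r = N * N ^ (r - 1) := by
      rw [← Real.rpow_one_add' (norm_nonneg _) (by linarith), add_sub_cancel]
    rw [hsplit] at hle
    exact le_of_mul_le_mul_right hle hNpos

/-- Boundedness of the Riesz projection on trigonometric polynomials. -/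
theorem exists_norm_nonnegPart_le {p : ℝ≥0∞} [Fact (1 ≤ p)] (hp₁ : 1 < p) (hp : p ≠ ⊤) :
    ∃ A : ℝ, ∀ a : ℤ →₀ ℂ,
      ‖circleToLp p (trigPoly (nonnegPart a))‖ ≤ A * ‖circleToLp p (trigPoly a)‖ := by
  rcases le_total p 2 with hp₂ | hp₂
  · obtain ⟨A, -, hA⟩ := exists_norm_nonnegPart_le_of_le_two hp₁ hp₂
    exact ⟨A, hA⟩
  · have h2 : 2 ≤ p.toReal := by
      rw [← ENNReal.toReal_ofNat]; exact ENNReal.toReal_mono hp hp₂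
    have hconj := Real.HolderConjugate.conjExponent (show 1 < p.toReal by linarith)
    set s := p.toReal.conjExponent
    have hs1 : 1 < s := hconj.symm.lt
    have hs2 : s ≤ 2 := by
      have : s = p.toReal / (p.toReal - 1) := rfl
      rw [this, div_le_iff₀ (by linarith)]
      linarith
    have hq1 : 1 < ENNReal.ofReal s := by
      rw [← ENNReal.ofReal_one]; exact (ENNReal.ofReal_lt_ofReal_iff (by linarith)).2 hs1
    have hq2 : ENNReal.ofReal s ≤ 2 := by
      rw [← ENNReal.ofReal_ofNat]; exact ENNReal.ofReal_le_ofReal hs2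
    have : Fact (1 ≤ ENNReal.ofReal s) := ⟨hq1.le⟩
    obtain ⟨A, hA0, hA⟩ := exists_norm_nonnegPart_le_of_le_two hq1 hq2
    exact ⟨A, norm_nonnegPart_le_of_conjugate hp ENNReal.ofReal_ne_top
      (by rwa [ENNReal.toReal_ofReal (by linarith)]) h2 hA0 hA⟩

theorem circleToLp_trigPoly_single (p : ℝ≥0∞) [Fact (1 ≤ p)] (k : ℤ) :
    circleToLp p (trigPoly (Finsupp.single k 1)) = fourierLp p k := by
  rw [trigPoly_single, one_smul]

theorem denseRange_circleToLp_trigPoly {p : ℝ≥0∞} [Fact (1 ≤ p)] (hp : p ≠ ⊤) :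
    DenseRange ((circleToLp p).toLinearMap ∘ₗ trigPoly) := by
  rw [LinearMap.coe_comp]
  refine (ContinuousMap.toLp_denseRange ℂ μ𝕋 ℂ hp).comp ?_ (circleToLp p).continuous
  intro f
  refine Metric.mem_closure_iff.2 fun ε hε => ?_
  obtain ⟨a, ha⟩ := exists_norm_trigPoly_sub_lt f hε
  exact ⟨_, ⟨a, rfl⟩, by rwa [dist_comm, dist_eq_norm]⟩

theorem fourierLp_mem_HardyLp (p : ℝ≥0∞) [Fact (1 ≤ p)] {k : ℤ} (hk : 0 ≤ k) :
    fourierLp p k ∈ HardyLp p := by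
  obtain ⟨n, rfl⟩ := Int.eq_ofNat_of_zero_le hk
  exact Submodule.le_topologicalClosure _ (Submodule.subset_span ⟨n, rfl⟩)

theorem ext_of_fourierLp {p : ℝ≥0∞} [Fact (1 ≤ p)] (hp : p ≠ ⊤) {A B : Lp ℂ p μ𝕋 →L[ℂ] Lp ℂ p μ𝕋}
    (h : ∀ k, A (fourierLp p k) = B (fourierLp p k)) : A = B := by
  refine ContinuousLinearMap.ext_on (s := Set.range (fourierLp (T := 2 * π) p)) ?_ ?_
  · exact Submodule.dense_iff_topologicalClosure_eq_top.2 (span_fourierLp_closure_eq_top hp)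
  · rintro _ ⟨k, rfl⟩
    exact h k

theorem eq_on_HardyLp {p : ℝ≥0∞} [Fact (1 ≤ p)] {A B : Lp ℂ p μ𝕋 →L[ℂ] Lp ℂ p μ𝕋}
    (h : ∀ k : ℤ, 0 ≤ k → A (fourierLp p k) = B (fourierLp p k)) {v : Lp ℂ p μ𝕋}
    (hv : v ∈ HardyLp p) : A v = B v := by
  have hle : HardyLp p ≤ LinearMap.eqLocus A.toLinearMap B.toLinearMap := by
    refine Submodule.topologicalClosure_minimal _ (Submodule.span_le.2 ?_)
      (isClosed_eq A.continuous B.continuous)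
    rintro _ ⟨n, rfl⟩
    exact h n (by positivity)
  exact hle hv

theorem exists_continuousLinearMap_of_norm_le {V E F : Type*} [AddCommGroup V] [Module ℂ V]
    [NormedAddCommGroup E] [NormedSpace ℂ E] [NormedAddCommGroup F] [NormedSpace ℂ F]
    [CompleteSpace F] {e : V →ₗ[ℂ] E} {f : V →ₗ[ℂ] F} (he : DenseRange e)
    (h : ∃ C : ℝ, ∀ a, ‖f a‖ ≤ C * ‖e a‖) : ∃ Q : E →L[ℂ] F, ∀ a, Q (e a) = f a :=
  ⟨f.extendOfNorm e, LinearMap.extendOfNorm_eq he h⟩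

/-- The Riesz projection. -/
theorem exists_rieszProjection {p : ℝ≥0∞} [Fact (1 ≤ p)] (hp₁ : 1 < p) (hp : p ≠ ⊤) :
    ∃ Q : Lp ℂ p μ𝕋 →L[ℂ] Lp ℂ p μ𝕋, (∀ k : ℤ, 0 ≤ k → Q (fourierLp p k) = fourierLp p k) ∧
      ∀ k : ℤ, k < 0 → Q (fourierLp p k) = 0 := by
  obtain ⟨A, hA⟩ := exists_norm_nonnegPart_le hp₁ hp
  obtain ⟨Q, hQ⟩ := exists_continuousLinearMap_of_norm_le (denseRange_circleToLp_trigPoly hp)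
    (f := (circleToLp p).toLinearMap ∘ₗ trigPoly ∘ₗ nonnegPart) ⟨A, hA⟩
  have hQ' (a : ℤ →₀ ℂ) :
      Q (circleToLp p (trigPoly a)) = circleToLp p (trigPoly (nonnegPart a)) := hQ a
  refine ⟨Q, fun k hk => ?_, fun k hk => ?_⟩
  · rw [← circleToLp_trigPoly_single, hQ', nonnegPart_single, if_pos hk]
  · rw [← circleToLp_trigPoly_single, hQ', nonnegPart_single, if_neg hk.not_ge, map_zero, map_zero]

/-- The mean of a bounded, strongly continuous family of operators. -/
theorem exists_mean_operator {E : Type*} [NormedAddCommGroup E] [NormedSpace ℂ E]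
    (K : 𝕋 → E →L[ℂ] E) (hK : ∀ f, Continuous fun g => K g f) {C : ℝ} (hC : 0 ≤ C)
    (hKC : ∀ g, ‖K g‖ ≤ C) :
    ∃ A : E →L[ℂ] E, ‖A‖ ≤ C ∧ ∀ f, A f = ∫ g, K g f ∂μ𝕋 := by
  let L : E →ₗ[ℂ] E :=
    { toFun := fun f => ∫ g, K g f ∂μ𝕋
      map_add' := fun f h => by
        simp only [map_add]
        exact integral_add (integrable_haarAddCircle (hK f)) (integrable_haarAddCircle (hK h))
      map_smul' := fun c f => by
        simp only [map_smul, RingHom.id_apply]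
        exact integral_smul c _ }
  refine ⟨L.mkContinuous C fun f => ?_, L.mkContinuous_norm_le hC _, fun f => rfl⟩
  have h := norm_integral_le_of_norm_le_const (μ := μ𝕋) (f := fun g => K g f) (C := C * ‖f‖)
    (.of_forall fun g => (K g).le_of_opNorm_le (hKC g) f)
  rwa [probReal_univ, mul_one] at h

section Rotation

variable {p : ℝ≥0∞} [Fact (1 ≤ p)] {Trot : 𝕋 → Lp ℂ p μ𝕋 →L[ℂ] Lp ℂ p μ𝕋}

theorem rotation_eq_vadd
    (hTrot : ∀ (g : 𝕋) (f : Lp ℂ p μ𝕋), (Trot g f : 𝕋 → ℂ) =ᵐ[μ𝕋] fun x => f (x + g))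
    (g : 𝕋) (f : Lp ℂ p μ𝕋) : Trot g f = DomAddAct.mk g +ᵥ f := by
  refine Lp.ext ((hTrot g f).trans (.trans (.of_forall fun x => ?_)
    (DomAddAct.vadd_Lp_ae_eq (DomAddAct.mk g) f).symm))
  simp [add_comm]

theorem norm_rotation
    (hTrot : ∀ (g : 𝕋) (f : Lp ℂ p μ𝕋), (Trot g f : 𝕋 → ℂ) =ᵐ[μ𝕋] fun x => f (x + g))
    (g : 𝕋) (f : Lp ℂ p μ𝕋) : ‖Trot g f‖ = ‖f‖ := by
  rw [rotation_eq_vadd hTrot, DomAddAct.norm_vadd_Lp]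

theorem continuous_rotation (hp : p ≠ ⊤)
    (hTrot : ∀ (g : 𝕋) (f : Lp ℂ p μ𝕋), (Trot g f : 𝕋 → ℂ) =ᵐ[μ𝕋] fun x => f (x + g)) :
    Continuous fun z : 𝕋 × Lp ℂ p μ𝕋 => Trot z.1 z.2 := by
  have : Fact (p ≠ ⊤) := ⟨hp⟩
  simp only [rotation_eq_vadd hTrot]
  exact (DomAddAct.continuous_mk.comp continuous_fst).vadd continuous_snd

theorem rotation_fourierLp
    (hTrot : ∀ (g : 𝕋) (f : Lp ℂ p μ𝕋), (Trot g f : 𝕋 → ℂ) =ᵐ[μ𝕋] fun x => f (x + g))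
    (g : 𝕋) (k : ℤ) : Trot g (fourierLp p k) = fourier k g • fourierLp p k := by
  have h1 : (fun x => (fourierLp p k : 𝕋 → ℂ) (x + g)) =ᵐ[μ𝕋] fun x => fourier k (x + g) :=
    (measurePreserving_add_right μ𝕋 g).quasiMeasurePreserving.ae_eq_comp (coeFn_fourierLp p k)
  refine Lp.ext ?_
  filter_upwards [hTrot g (fourierLp p k), h1, coeFn_fourierLp (T := 2 * π) p k,
    Lp.coeFn_smul (fourier k g) (fourierLp (T := 2 * π) p k)] with x e1 e2 e3 e4
  rw [e1, e2, e4, Pi.smul_apply, e3, smul_eq_mul, fourier_apply, smul_add, AddCircle.toCircle_add,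
    Circle.coe_mul, fourier_apply, fourier_apply, mul_comm]

theorem fourier_mul_fourier_neg_arg (k : ℤ) (g : 𝕋) :
    fourier k g * fourier k (-g) = 1 := by
  rw [fourier_apply, fourier_apply, ← Circle.coe_mul, ← AddCircle.toCircle_add]
  simp

/-- On the Hardy space the spectral projections of the rotations at negative frequencies vanish. -/
theorem integral_fourier_smul_rotation_eq_zero (hp : p ≠ ⊤)
    (hTrot : ∀ (g : 𝕋) (f : Lp ℂ p μ𝕋), (Trot g f : 𝕋 → ℂ) =ᵐ[μ𝕋] fun x => f (x + g))
    {k : ℤ} (hk : k < 0) {w : Lp ℂ p μ𝕋} (hw : w ∈ HardyLp p) :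
    ∫ g, fourier k g • Trot (-g) w ∂μ𝕋 = 0 := by
  have hcont := continuous_rotation hp hTrot
  obtain ⟨B, -, hB⟩ := exists_mean_operator (fun g => fourier k g • Trot (-g))
    (fun f => (map_continuous (fourier k)).smul
      (hcont.comp (continuous_neg.prodMk continuous_const))) zero_le_one (fun g => by
        refine ContinuousLinearMap.opNorm_le_bound _ zero_le_one fun f => ?_
        rw [smul_apply, norm_smul, norm_rotation hTrot, fourier_apply,
          Circle.norm_coe])
  have h := eq_on_HardyLp (A := B) (B := 0) (fun j hj => ?_) hw
  · rw [hB] at h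
    exact h
  · rw [hB]
    have e : ∀ g : 𝕋, (fourier k g • Trot (-g)) (fourierLp p j) =
        (fourier (-j) g • fourier k g) • fourierLp p j := fun g => by
      have : fourier j (-g) = fourier (-j) g := by simp [fourier_apply]
      rw [smul_apply, rotation_fourierLp hTrot, smul_smul, this, smul_eq_mul,
        mul_comm (fourier k g)]
    simp only [e]
    rw [integral_smul_const]
    have h0 : ∫ g : 𝕋, fourier (-j) g • fourier k g ∂μ𝕋 = 0 := by
      have h1 := congr_fun (fourierCoeff_fourier (T := 2 * π) k) j
      rw [Pi.single_eq_of_ne (by omega)] at h1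
      exact h1
    rw [h0, zero_smul, zero_apply]

/-- Averaging any projection onto the Hardy space over the rotations gives the Riesz projection. -/
theorem rieszProjection_eq_mean (hp : p ≠ ⊤)
    (hTrot : ∀ (g : 𝕋) (f : Lp ℂ p μ𝕋), (Trot g f : 𝕋 → ℂ) =ᵐ[μ𝕋] fun x => f (x + g))
    {Q P : Lp ℂ p μ𝕋 →L[ℂ] Lp ℂ p μ𝕋}
    (hQ : ∀ k : ℤ, 0 ≤ k → Q (fourierLp p k) = fourierLp p k)
    (hQ' : ∀ k : ℤ, k < 0 → Q (fourierLp p k) = 0)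
    (hP : ∀ f, P f ∈ HardyLp p) (hP' : ∀ v ∈ HardyLp p, P v = v) :
    ‖Q‖ ≤ ‖P‖ ∧ ∀ f, Q f = ∫ g, Trot (-g) (P (Trot g f)) ∂μ𝕋 := by
  have hcont := continuous_rotation hp hTrot
  obtain ⟨A, hA, hAf⟩ := exists_mean_operator (fun g => Trot (-g) ∘L P ∘L Trot g)
    (fun f => hcont.comp (continuous_neg.prodMk
      (P.continuous.comp (hcont.comp (continuous_id.prodMk continuous_const)))))
    (norm_nonneg P) (fun g => by
      refine ContinuousLinearMap.opNorm_le_bound _ (norm_nonneg P) fun f => ?_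
      rw [ContinuousLinearMap.comp_apply, ContinuousLinearMap.comp_apply, norm_rotation hTrot,
        ← norm_rotation hTrot g f]
      exact P.le_opNorm _)
  have hQA : Q = A := by
    refine ext_of_fourierLp hp fun k => ?_
    rw [hAf]
    simp only [ContinuousLinearMap.comp_apply, rotation_fourierLp hTrot, map_smul]
    rcases lt_or_ge k 0 with hk | hk
    · rw [hQ' k hk]
      exact (integral_fourier_smul_rotation_eq_zero hp hTrot hk (hP _)).symm
    · simp only [hQ k hk, hP' _ (fourierLp_mem_HardyLp p hk), rotation_fourierLp hTrot, smul_smul,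
        fourier_mul_fourier_neg_arg, one_smul]
      rw [integral_const, probReal_univ]
      exact (one_smul ℝ _).symm
  subst hQA
  exact ⟨hA, hAf⟩

end Rotation

/-- **M. Riesz.** For `1 < p < ∞` there is a bounded linear projection of `L^p` onto the Hardy
space `H^p`; the projection `Q` determined by `Q e_k = e_k` for `k ≥ 0` and `Q e_k = 0` for
`k < 0` is a bounded projection of `L^p` onto `H^p`, it is the unique bounded projection of
`L^p` onto `H^p` commuting with all rotations `(T_g f)(t) = f (t + g)`, and it is a minimal
projection: `‖Q‖ ≤ ‖P‖` for every bounded linear projection `P` of `L^p` onto `H^p`.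

The rotations are given here as a family `Trot` of bounded operators on `L^p` specified by the
pointwise a.e. property `(Trot g f)(x) = f (x + g)`. -/
theorem riesz_projection_unique_commuting_minimal
    (p : ℝ≥0∞) [Fact (1 ≤ p)] (hp₁ : 1 < p) (hp₂ : p ≠ ⊤)
    (Trot : AddCircle (2 * π) →
      Lp ℂ p (@haarAddCircle (2 * π) _) →L[ℂ] Lp ℂ p (@haarAddCircle (2 * π) _))
    (hTrot : ∀ (g : AddCircle (2 * π)) (f : Lp ℂ p (@haarAddCircle (2 * π) _)),
      (Trot g f : AddCircle (2 * π) → ℂ) =ᵐ[@haarAddCircle (2 * π) _]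
        fun x => f (x + g)) :
    ∃ Q : Lp ℂ p (@haarAddCircle (2 * π) _) →L[ℂ] Lp ℂ p (@haarAddCircle (2 * π) _),
      (∀ f, Q f ∈ HardyLp p) ∧ (∀ v ∈ HardyLp p, Q v = v) ∧
      (∀ k : ℤ, 0 ≤ k → Q (fourierLp p k) = fourierLp p k) ∧
      (∀ k : ℤ, k < 0 → Q (fourierLp p k) = 0) ∧
      (∀ (g : AddCircle (2 * π)) (f : Lp ℂ p (@haarAddCircle (2 * π) _)),
        Q (Trot g f) = Trot g (Q f)) ∧
      (∀ P : Lp ℂ p (@haarAddCircle (2 * π) _) →L[ℂ] Lp ℂ p (@haarAddCircle (2 * π) _),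
        (∀ f, P f ∈ HardyLp p) → (∀ v ∈ HardyLp p, P v = v) →
        (∀ (g : AddCircle (2 * π)) (f : Lp ℂ p (@haarAddCircle (2 * π) _)),
          P (Trot g f) = Trot g (P f)) → P = Q) ∧
      (∀ P : Lp ℂ p (@haarAddCircle (2 * π) _) →L[ℂ] Lp ℂ p (@haarAddCircle (2 * π) _),
        (∀ f, P f ∈ HardyLp p) → (∀ v ∈ HardyLp p, P v = v) → ‖Q‖ ≤ ‖P‖) := by
  obtain ⟨Q, hQ, hQ'⟩ := exists_rieszProjection hp₁ hp₂
  have hmem : ∀ f, Q f ∈ HardyLp p := by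
    have hle : (⊤ : Submodule ℂ (Lp ℂ p (@haarAddCircle (2 * π) _))) ≤
        (HardyLp p).comap Q.toLinearMap := by
      rw [← span_fourierLp_closure_eq_top hp₂]
      refine Submodule.topologicalClosure_minimal _ (Submodule.span_le.2 ?_)
        ((Submodule.isClosed_topologicalClosure _).preimage Q.continuous)
      rintro _ ⟨k, rfl⟩
      change Q (fourierLp p k) ∈ HardyLp p
      rcases lt_or_ge k 0 with hk | hk
      · rw [hQ' k hk]; exact zero_mem _
      · rw [hQ k hk]; exact fourierLp_mem_HardyLp p hk
    exact fun f => hle trivial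
  refine ⟨Q, hmem, fun v hv => ?_, hQ, hQ', fun g f => ?_, fun P hP hP' hcomm => ?_,
    fun P hP hP' => (rieszProjection_eq_mean hp₂ hTrot hQ hQ' hP hP').1⟩
  · exact eq_on_HardyLp (A := Q) (B := .id ℂ _) hQ hv
  · have h : Q ∘L Trot g = Trot g ∘L Q := by
      refine ext_of_fourierLp hp₂ fun k => ?_
      rw [ContinuousLinearMap.comp_apply, ContinuousLinearMap.comp_apply, rotation_fourierLp hTrot,
        map_smul]
      rcases lt_or_ge k 0 with hk | hk
      · rw [hQ' k hk, smul_zero, map_zero]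
      · rw [hQ k hk, rotation_fourierLp hTrot]
    exact DFunLike.congr_fun h f
  · refine ext_of_fourierLp hp₂ fun k => ?_
    rw [(rieszProjection_eq_mean hp₂ hTrot hQ hQ' hP hP').2]
    simp only [← hcomm, rotation_fourierLp hTrot, map_smul, smul_smul,
      fourier_mul_fourier_neg_arg, one_smul]
    rw [integral_const, probReal_univ]
    exact (one_smul ℝ _).symm
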